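/- MSPE consistency of ridge regression for near low-rank designs: Suppose X ∈ ℝ^{n×p} is fixed with k₃ ≤ p/n ≤ k₄ for constants 0 < k₃ ≤ k₄, the eigenvalues of Σ̂ = (1/n)XᵀX satisfy κ₁ i^{-ν} ≤ λ_i(Σ̂) ≤ κ₂ i^{-ν} for all i = 1,…,min(n,p) (constants κ₁, κ₂ > 0, ν > 0), ‖β‖₂ ≤ b₀, and the ridge parameter satisfies ϱ/n = n^{-θ} with θ = 2ν/3 if ν ∈ (0,1/2) and θ = ν/(ν+1) if ν > 1/2. Then there exists a constant C > 0 depending only on (κ₁, κ₂, ν, k₃, k₄, b₀, σ²) such that for all n ≥ 1: mspe(β̂_ϱ|X) ≤ C·n^{-2ν/3} if ν ∈ (0,1/2), and mspe(β̂_ϱ|X) ≤ C·n^{-ν/(ν+1)} if ν > 1/2. -/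

import Mathlib

open MeasureTheory Matrix
open scoped ENNReal NNReal

/-- The ridge regression estimator with parameter `ϱ`. -/
noncomputable def ridge {n p : ℕ} (X : Matrix (Fin n) (Fin p) ℝ) (ϱ : ℝ) (Y : Fin n → ℝ) :
    Fin p → ℝ :=
  (Xᵀ * X + ϱ • (1 : Matrix (Fin p) (Fin p) ℝ))⁻¹ *ᵥ (Xᵀ *ᵥ Y)

/-- The mean-squared prediction error `mspe(β̂|X) = (1/n) E[‖X(β̂ − β)‖₂²]`, where the
expectation is over `ε` with i.i.d. coordinates of law `F₀` and `Y = Xβ + ε`. -/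
noncomputable def mspeE {n p : ℕ} (X : Matrix (Fin n) (Fin p) ℝ) (β : Fin p → ℝ)
    (est : (Fin n → ℝ) → (Fin p → ℝ)) (F₀ : Measure ℝ) : ℝ≥0∞ :=
  (n : ℝ≥0∞)⁻¹ *
    ∫⁻ ε, ENNReal.ofReal (∑ i, ((X *ᵥ est (X *ᵥ β + ε)) i - (X *ᵥ β) i) ^ 2)
      ∂(Measure.pi fun _ : Fin n => F₀)

theorem rpow_neg_le_sub_rpow {s : ℝ} (hs0 : 0 ≤ s) (hs : s < 1) (i : ℕ) :
    (1 - s) * ((i : ℝ) + 1) ^ (-s) ≤ ((i : ℝ) + 1) ^ (1 - s) - (i : ℝ) ^ (1 - s) := by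
  have hi : (0 : ℝ) < (i : ℝ) + 1 := by positivity
  have hinv : ((i : ℝ) + 1)⁻¹ ≤ 1 := inv_le_one_of_one_le₀ (by simp)
  have h := rpow_one_add_le_one_add_mul_self (s := -((i : ℝ) + 1)⁻¹) (by linarith)
    (p := 1 - s) (by linarith) (by linarith)
  have hbase : 1 + -((i : ℝ) + 1)⁻¹ = (i : ℝ) / (i + 1) := by field_simp; ring
  rw [hbase, Real.div_rpow (by positivity) hi.le, div_le_iff₀ (by positivity)] at h
  have hpow : ((i : ℝ) + 1) ^ (1 - s) = (i + 1) * (i + 1) ^ (-s) := by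
    rw [sub_eq_add_neg, Real.rpow_add hi, Real.rpow_one]
  have hcancel : (1 + (1 - s) * -((i : ℝ) + 1)⁻¹) * ((i + 1) * (i + 1) ^ (-s))
      = (i + 1) * ((i : ℝ) + 1) ^ (-s) - (1 - s) * (i + 1) ^ (-s) := by
    field_simp
    ring
  rw [hpow] at h ⊢
  linarith

theorem sum_range_rpow_neg_le {s : ℝ} (hs0 : 0 ≤ s) (hs : s < 1) (p : ℕ) :
    ∑ i ∈ Finset.range p, ((i : ℝ) + 1) ^ (-s) ≤ (p : ℝ) ^ (1 - s) / (1 - s) := by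
  have hs' : 0 < 1 - s := by linarith
  rw [le_div_iff₀' hs', Finset.mul_sum]
  calc _ ≤ ∑ i ∈ Finset.range p, (((i + 1 : ℕ) : ℝ) ^ (1 - s) - (i : ℝ) ^ (1 - s)) :=
        Finset.sum_le_sum fun i _ => by
          push_cast
          exact rpow_neg_le_sub_rpow hs0 hs i
    _ = (p : ℝ) ^ (1 - s) := by
        rw [Finset.sum_range_sub fun i : ℕ => (i : ℝ) ^ (1 - s)]
        simp [Real.zero_rpow hs'.ne']

theorem sum_Ico_rpow_neg_le {s : ℝ} (hs : 1 < s) {m q : ℕ} (hm : 1 ≤ m) (hmq : m ≤ q) :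
    ∑ i ∈ Finset.Ico m q, ((i : ℝ) + 1) ^ (-s) ≤ (m : ℝ) ^ (1 - s) / (s - 1) := by
  have hm' : (0 : ℝ) < m := by exact_mod_cast hm
  have hmq' : (m : ℝ) ≤ q := by exact_mod_cast hmq
  have hanti : AntitoneOn (fun x : ℝ => x ^ (-s)) (Set.Icc m q) := fun x hx y _ hxy =>
    Real.rpow_le_rpow_of_nonpos (hm'.trans_le hx.1) hxy (by linarith)
  have h := hanti.sum_le_integral_Ico hmq
  rw [integral_rpow (Or.inr ⟨by linarith, by
    rw [Set.uIcc_of_le hmq']; exact fun h0 => absurd h0.1 (not_le.mpr hm')⟩)] at h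
  push_cast at h
  refine h.trans ?_
  have hq : 0 ≤ (q : ℝ) ^ (1 - s) := by positivity
  rw [show -s + 1 = 1 - s by ring, ← neg_div_neg_eq, neg_sub, neg_sub]
  gcongr
  linarith

theorem div_add_sq_le_one {l τ : ℝ} (hl : 0 ≤ l) (hτ : 0 < τ) : (l / (l + τ)) ^ 2 ≤ 1 :=
  pow_le_one₀ (by positivity) (div_le_one_of_le₀ (by linarith) (by positivity))

theorem div_add_sq_le {l τ K ν x : ℝ} (hl : 0 ≤ l) (hτ : 0 < τ) (hx : 0 ≤ x)
    (h : l ≤ K * x ^ (-ν)) : (l / (l + τ)) ^ 2 ≤ K ^ 2 / τ ^ 2 * x ^ (-(2 * ν)) := by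
  have hsq : x ^ (-(2 * ν)) = (x ^ (-ν)) ^ 2 := by
    rw [← Real.rpow_natCast, ← Real.rpow_mul hx]; congr 1; push_cast; ring
  calc (l / (l + τ)) ^ 2 ≤ (l / τ) ^ 2 := by gcongr; linarith
    _ ≤ (K * x ^ (-ν) / τ) ^ 2 := by gcongr
    _ = _ := by rw [hsq]; ring

theorem sum_div_add_sq_le_of_lt {ν K τ : ℝ} (hν : 0 < ν) (hν' : ν < 1 / 2) (hτ : 0 < τ) {p : ℕ}
    {l : Fin p → ℝ} (hl : ∀ i, 0 ≤ l i) (hlK : ∀ i, l i ≤ K * ((i : ℕ) + 1 : ℝ) ^ (-ν)) :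
    ∑ i, (l i / (l i + τ)) ^ 2 ≤ K ^ 2 / τ ^ 2 * ((p : ℝ) ^ (1 - 2 * ν) / (1 - 2 * ν)) := by
  calc ∑ i, (l i / (l i + τ)) ^ 2
      ≤ ∑ i : Fin p, K ^ 2 / τ ^ 2 * ((i : ℕ) + 1 : ℝ) ^ (-(2 * ν)) :=
        Finset.sum_le_sum fun i _ => div_add_sq_le (hl i) hτ (by positivity) (hlK i)
    _ = K ^ 2 / τ ^ 2 * ∑ i ∈ Finset.range p, ((i : ℝ) + 1) ^ (-(2 * ν)) := by
        rw [← Finset.mul_sum, Fin.sum_univ_eq_sum_range (fun i => ((i : ℝ) + 1) ^ (-(2 * ν)))]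
    _ ≤ _ := by
        gcongr
        exact sum_range_rpow_neg_le (by linarith) (by linarith) p

theorem sum_div_add_sq_le_of_gt {ν K τ : ℝ} (hν : 1 / 2 < ν) (hτ : 0 < τ) (hτ1 : τ ≤ 1) {p : ℕ}
    {l : Fin p → ℝ} (hl : ∀ i, 0 ≤ l i) (hlK : ∀ i, l i ≤ K * ((i : ℕ) + 1 : ℝ) ^ (-ν)) :
    ∑ i, (l i / (l i + τ)) ^ 2 ≤ (2 + K ^ 2 / (2 * ν - 1)) * τ ^ (-(1 / ν)) := by
  set T : ℝ := τ ^ (-(1 / ν)) with hT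
  have hν0 : 0 < ν := by linarith
  have hν2 : 0 < 2 * ν - 1 := by linarith
  have hT1 : 1 ≤ T := Real.one_le_rpow_of_pos_of_le_one_of_nonpos hτ hτ1
    (neg_nonpos.mpr (by positivity))
  have hT0 : 0 < T := by linarith
  set m : ℕ := ⌈T⌉₊ with hm
  have hTm : T ≤ m := Nat.le_ceil T
  have hm1 : 1 ≤ m := Nat.one_le_iff_ne_zero.mpr fun h => by
    rw [h] at hTm; norm_num at hTm; linarith
  have hm2 : (m : ℝ) ≤ 2 * T := by linarith [Nat.ceil_lt_add_one hT0.le]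
  have hτT : τ ^ 2 = T ^ (-(2 * ν)) := by
    rw [hT, ← Real.rpow_mul hτ.le, ← Real.rpow_natCast]; congr 1; push_cast; field_simp
  set G : ℕ → ℝ := fun i => min 1 (K ^ 2 / τ ^ 2 * ((i : ℝ) + 1) ^ (-(2 * ν)))
  have hG : ∀ i, 0 ≤ G i := fun i => le_min zero_le_one (by positivity)
  calc ∑ i, (l i / (l i + τ)) ^ 2 ≤ ∑ i : Fin p, G i :=
        Finset.sum_le_sum fun i _ => le_min (div_add_sq_le_one (hl i) hτ)
          (div_add_sq_le (hl i) hτ (by positivity) (hlK i))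
    _ = ∑ i ∈ Finset.range p, G i := Fin.sum_univ_eq_sum_range G p
    _ ≤ ∑ i ∈ Finset.range (max m p), G i :=
        Finset.sum_le_sum_of_subset_of_nonneg (Finset.range_mono (le_max_right _ _))
          fun i _ _ => hG i
    _ = ∑ i ∈ Finset.range m, G i + ∑ i ∈ Finset.Ico m (max m p), G i :=
        (Finset.sum_range_add_sum_Ico _ (le_max_left _ _)).symm
    _ ≤ ∑ i ∈ Finset.range m, 1 + ∑ i ∈ Finset.Ico m (max m p),
          K ^ 2 / τ ^ 2 * ((i : ℝ) + 1) ^ (-(2 * ν)) :=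
        add_le_add (Finset.sum_le_sum fun i _ => min_le_left _ _)
          (Finset.sum_le_sum fun i _ => min_le_right _ _)
    _ ≤ 2 * T + K ^ 2 / τ ^ 2 * (T ^ (1 - 2 * ν) / (2 * ν - 1)) := by
        rw [← Finset.mul_sum]
        gcongr
        · simpa using hm2
        · refine (sum_Ico_rpow_neg_le (by linarith) hm1 (le_max_left _ _)).trans ?_
          gcongr ?_ / _
          exact Real.rpow_le_rpow_of_nonpos hT0 hTm (by linarith)
    _ = _ := by
        have : T ^ (1 - 2 * ν) = T * τ ^ 2 := by
          rw [hτT, sub_eq_add_neg, Real.rpow_add hT0, Real.rpow_one]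
        rw [this]
        field_simp

section Noise

variable {ι κ : Type*} [Fintype ι] [Fintype κ] {F₀ : Measure ℝ} [IsProbabilityMeasure F₀]

theorem memLp_dotProduct_pi (h : MemLp id 2 F₀) (v : ι → ℝ) :
    MemLp (fun ε : ι → ℝ => v ⬝ᵥ ε) 2 (Measure.pi fun _ => F₀) :=
  memLp_finsetSum (f := fun i (ε : ι → ℝ) => v i * ε i) _ fun i _ =>
    (h.comp_measurePreserving (measurePreserving_eval (fun _ : ι => F₀) i)).const_mul (v i)

theorem integral_dotProduct_pi (h : MemLp id 2 F₀) (hmean : ∫ x, x ∂F₀ = 0) (v : ι → ℝ) :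
    ∫ ε : ι → ℝ, v ⬝ᵥ ε ∂(Measure.pi fun _ => F₀) = 0 := by
  simp only [dotProduct]
  have hint : ∀ i, Integrable (fun ε : ι → ℝ => v i * ε i) (Measure.pi fun _ => F₀) := fun i =>
    ((h.comp_measurePreserving (measurePreserving_eval (fun _ : ι => F₀) i)).integrable
      one_le_two).const_mul (v i)
  rw [integral_finsetSum _ fun i _ => hint i]
  refine Finset.sum_eq_zero fun i _ => ?_
  rw [integral_const_mul, integral_comp_eval (μ := fun _ : ι => F₀) (f := fun x => x)
    aestronglyMeasurable_id, hmean, mul_zero]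

theorem integral_dotProduct_sq_pi (h : MemLp id 2 F₀) (hmean : ∫ x, x ∂F₀ = 0) (v : ι → ℝ) :
    ∫ ε : ι → ℝ, (v ⬝ᵥ ε) ^ 2 ∂(Measure.pi fun _ => F₀)
      = (∫ x, x ^ 2 ∂F₀) * ∑ i, v i ^ 2 := by
  rw [← ProbabilityTheory.variance_of_integral_eq_zero
    (memLp_dotProduct_pi h v).aestronglyMeasurable.aemeasurable (integral_dotProduct_pi h hmean v)]
  have hsum := ProbabilityTheory.variance_sum_pi (μ := fun _ : ι => F₀)
    (X := fun i x => v i * x) fun i => h.const_mul (v i)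
  have hvar : ProbabilityTheory.variance (fun x : ℝ => x) F₀ = ∫ x, x ^ 2 ∂F₀ :=
    ProbabilityTheory.variance_of_integral_eq_zero aemeasurable_id hmean
  rw [Finset.mul_sum]
  convert hsum using 2
  · ext ε
    simp [dotProduct]
  · rw [ProbabilityTheory.variance_const_mul, hvar, mul_comm]

theorem lintegral_sum_add_mulVec_sq_pi (h : MemLp id 2 F₀) (hmean : ∫ x, x ∂F₀ = 0)
    (a : κ → ℝ) (A : Matrix κ ι ℝ) :
    ∫⁻ ε : ι → ℝ, ENNReal.ofReal (∑ i, (a i + (A *ᵥ ε) i) ^ 2) ∂(Measure.pi fun _ => F₀)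
      = ENNReal.ofReal (∑ i, a i ^ 2 + (∫ x, x ^ 2 ∂F₀) * ∑ i, ∑ j, A i j ^ 2) := by
  have hLp : ∀ i, MemLp (fun ε : ι → ℝ => (A *ᵥ ε) i) 2 (Measure.pi fun _ => F₀) :=
    fun i => memLp_dotProduct_pi h (A i)
  have hint : ∀ i, Integrable (fun ε : ι → ℝ => (a i + (A *ᵥ ε) i) ^ 2)
      (Measure.pi fun _ => F₀) := fun i => ((memLp_const (a i)).add (hLp i)).integrable_sq
  rw [← ofReal_integral_eq_lintegral_ofReal (integrable_finsetSum _ fun i _ => hint i)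
    (Filter.Eventually.of_forall fun ε => Finset.sum_nonneg fun i _ => sq_nonneg _),
    integral_finsetSum _ fun i _ => hint i, Finset.mul_sum, ← Finset.sum_add_distrib]
  congr 2 with i
  have hlin : Integrable (fun ε : ι → ℝ => 2 * a i * (A *ᵥ ε) i) (Measure.pi fun _ => F₀) :=
    ((hLp i).integrable one_le_two).const_mul _
  have hconst : Integrable (fun _ : ι → ℝ => a i ^ 2) (Measure.pi fun _ => F₀) :=
    integrable_const _
  simp only [add_sq]
  have hsq := (hLp i).integrable_sq
  rw [integral_add (f := fun ε : ι → ℝ => a i ^ 2 + 2 * a i * (A *ᵥ ε) i) (hconst.add hlin) hsq,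
    integral_add hconst hlin, integral_const_mul]
  have h0 := integral_dotProduct_pi h hmean (A i)
  have h2 := integral_dotProduct_sq_pi h hmean (A i)
  change ∫ ε : ι → ℝ, (A *ᵥ ε) i ∂_ = 0 at h0
  change ∫ ε : ι → ℝ, (A *ᵥ ε) i ^ 2 ∂_ = _ at h2
  rw [h0, h2]
  simp

end Noise

section Spectral

variable {p : Type*} [Fintype p] [DecidableEq p] {U : Matrix p p ℝ} {a : p → ℝ} {ϱ : ℝ}

theorem inv_conj_diagonal_add_smul_one (hU : U * Uᵀ = 1) (ha : ∀ i, 0 ≤ a i) (hϱ : 0 < ϱ) :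
    (U * diagonal a * Uᵀ + ϱ • (1 : Matrix p p ℝ))⁻¹
      = U * diagonal (fun i => (a i + ϱ)⁻¹) * Uᵀ := by
  have hU' : Uᵀ * U = 1 := mul_eq_one_comm.mp hU
  have hshift : U * diagonal a * Uᵀ + ϱ • (1 : Matrix p p ℝ)
      = U * diagonal (fun i => a i + ϱ) * Uᵀ := by
    have hd : diagonal (fun i => a i + ϱ) = diagonal a + ϱ • (1 : Matrix p p ℝ) := by
      rw [smul_one_eq_diagonal, diagonal_add]
    rw [hd, mul_add, add_mul, mul_smul_comm, mul_one, smul_mul_assoc, hU]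
  refine inv_eq_right_inv ?_
  rw [hshift]
  calc _ = U * diagonal (fun i => a i + ϱ) * (Uᵀ * U) * diagonal (fun i => (a i + ϱ)⁻¹) * Uᵀ := by
        simp only [Matrix.mul_assoc]
    _ = U * (diagonal (fun i => a i + ϱ) * diagonal (fun i => (a i + ϱ)⁻¹)) * Uᵀ := by
        rw [hU', mul_one, Matrix.mul_assoc U]
    _ = 1 := by
        rw [diagonal_mul_diagonal]
        have : ∀ i, (a i + ϱ) * (a i + ϱ)⁻¹ = 1 := fun i =>
          mul_inv_cancel₀ (by linarith [ha i])
        simp [this, hU]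

theorem conj_diagonal_mul (hU : Uᵀ * U = 1) (b c : p → ℝ) :
    U * diagonal b * Uᵀ * (U * diagonal c * Uᵀ) = U * diagonal (fun i => b i * c i) * Uᵀ := by
  calc _ = U * diagonal b * (Uᵀ * U) * diagonal c * Uᵀ := by simp only [Matrix.mul_assoc]
    _ = _ := by rw [hU, mul_one, Matrix.mul_assoc U, diagonal_mul_diagonal]

theorem dotProduct_conj_diagonal_mulVec (b v : p → ℝ) :
    v ⬝ᵥ ((U * diagonal b * Uᵀ) *ᵥ v) = ∑ i, b i * (Uᵀ *ᵥ v) i ^ 2 := by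
  rw [← mulVec_mulVec, ← mulVec_mulVec, dotProduct_mulVec, ← mulVec_transpose, dotProduct]
  exact Finset.sum_congr rfl fun i _ => by rw [mulVec_diagonal]; ring

variable {n : Type*} [Fintype n] {X : Matrix n p ℝ}

theorem sum_sq_mulVec_inv_gram_le (hU : U * Uᵀ = 1) (hX : Xᵀ * X = U * diagonal a * Uᵀ)
    (ha : ∀ i, 0 ≤ a i) (hϱ : 0 < ϱ) (v : p → ℝ) :
    ∑ i, ((X * (Xᵀ * X + ϱ • (1 : Matrix p p ℝ))⁻¹) *ᵥ v) i ^ 2 ≤ (4 * ϱ)⁻¹ * ∑ j, v j ^ 2 := by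
  have hU' : Uᵀ * U = 1 := mul_eq_one_comm.mp hU
  set S := (Xᵀ * X + ϱ • (1 : Matrix p p ℝ))⁻¹ with hS
  have hS' : S = U * diagonal (fun i => (a i + ϱ)⁻¹) * Uᵀ := by
    rw [hS, hX, inv_conj_diagonal_add_smul_one hU ha hϱ]
  have hST : Sᵀ = S := by
    rw [hS']; simp [Matrix.transpose_mul, Matrix.mul_assoc]
  have hnorm : ∑ j, v j ^ 2 = ∑ i, (Uᵀ *ᵥ v) i ^ 2 := by
    have h := dotProduct_conj_diagonal_mulVec (U := U) (fun _ => 1) v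
    simpa [hU, dotProduct, sq] using h
  have hquad : ∑ i, ((X * S) *ᵥ v) i ^ 2 = v ⬝ᵥ ((S * (Xᵀ * X) * S) *ᵥ v) := by
    have : S * (Xᵀ * X) * S = (X * S)ᵀ * (X * S) := by
      rw [transpose_mul, hST]; simp only [Matrix.mul_assoc]
    rw [this, ← mulVec_mulVec _ (X * S)ᵀ, dotProduct_mulVec, vecMul_transpose, dotProduct]
    exact Finset.sum_congr rfl fun i _ => sq _
  rw [hquad, hX, hS', conj_diagonal_mul hU', conj_diagonal_mul hU',
    dotProduct_conj_diagonal_mulVec, hnorm, Finset.mul_sum]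
  refine Finset.sum_le_sum fun i _ => ?_
  gcongr
  have hpos : 0 < a i + ϱ := by linarith [ha i]
  rw [show (a i + ϱ)⁻¹ * a i * (a i + ϱ)⁻¹ = a i / (a i + ϱ) ^ 2 by field_simp,
    div_le_iff₀ (by positivity), inv_mul_eq_div, le_div_iff₀ (by positivity)]
  nlinarith [sq_nonneg (a i - ϱ)]

theorem sum_sq_hat_matrix (hU : U * Uᵀ = 1) (hX : Xᵀ * X = U * diagonal a * Uᵀ)
    (ha : ∀ i, 0 ≤ a i) (hϱ : 0 < ϱ) :
    ∑ i, ∑ j, (X * (Xᵀ * X + ϱ • (1 : Matrix p p ℝ))⁻¹ * Xᵀ) i j ^ 2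
      = ∑ i, (a i / (a i + ϱ)) ^ 2 := by
  have hU' : Uᵀ * U = 1 := mul_eq_one_comm.mp hU
  set S := (Xᵀ * X + ϱ • (1 : Matrix p p ℝ))⁻¹ with hS
  have hS' : S = U * diagonal (fun i => (a i + ϱ)⁻¹) * Uᵀ := by
    rw [hS, hX, inv_conj_diagonal_add_smul_one hU ha hϱ]
  have hST : Sᵀ = S := by
    rw [hS']; simp [Matrix.transpose_mul, Matrix.mul_assoc]
  have htrace : ∑ i, ∑ j, (X * S * Xᵀ) i j ^ 2 = trace (X * S * Xᵀ * (X * S * Xᵀ)ᵀ) := by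
    refine Finset.sum_congr rfl fun i _ => ?_
    rw [diag_apply, Matrix.mul_apply (M := X * S * Xᵀ)]
    exact Finset.sum_congr rfl fun j _ => sq _
  have hcycle : trace (X * S * Xᵀ * (X * S * Xᵀ)ᵀ)
      = trace ((S * (Xᵀ * X)) * (S * (Xᵀ * X))) := by
    rw [transpose_mul, transpose_mul, transpose_transpose, hST, ← Matrix.mul_assoc X S Xᵀ,
      Matrix.mul_assoc X S, Matrix.mul_assoc X, trace_mul_comm]
    simp only [Matrix.mul_assoc]
  rw [htrace, hcycle, hX, hS', conj_diagonal_mul hU', conj_diagonal_mul hU', trace_mul_comm,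
    ← Matrix.mul_assoc, hU', one_mul, trace_diagonal]
  exact Finset.sum_congr rfl fun i _ => by ring

theorem mulVec_ridge_sub {n p : ℕ} (X : Matrix (Fin n) (Fin p) ℝ) {ϱ : ℝ} (hϱ : 0 < ϱ)
    (β : Fin p → ℝ) (ε : Fin n → ℝ) :
    X *ᵥ ridge X ϱ (X *ᵥ β + ε) - X *ᵥ β
      = (X * (Xᵀ * X + ϱ • (1 : Matrix (Fin p) (Fin p) ℝ))⁻¹) *ᵥ (-ϱ • β)
        + (X * (Xᵀ * X + ϱ • (1 : Matrix (Fin p) (Fin p) ℝ))⁻¹ * Xᵀ) *ᵥ ε := by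
  have hpos : (Xᵀ * X + ϱ • (1 : Matrix (Fin p) (Fin p) ℝ)).PosDef :=
    PosDef.posSemidef_add (by simpa using posSemidef_conjTranspose_mul_self X)
      (PosDef.one.smul hϱ)
  rw [ridge]
  set M := Xᵀ * X + ϱ • (1 : Matrix (Fin p) (Fin p) ℝ) with hM
  have hinv : M⁻¹ * M = 1 := nonsing_inv_mul _ ((isUnit_iff_isUnit_det _).mp hpos.isUnit)
  have hβ : X *ᵥ β = (X * M⁻¹) *ᵥ (Xᵀ *ᵥ (X *ᵥ β)) + (X * M⁻¹) *ᵥ (ϱ • β) := by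
    calc X *ᵥ β = (X * (M⁻¹ * M)) *ᵥ β := by rw [hinv, Matrix.mul_one]
      _ = (X * M⁻¹) *ᵥ (M *ᵥ β) := by rw [mulVec_mulVec, Matrix.mul_assoc]
      _ = _ := by
        have hMβ : M *ᵥ β = Xᵀ *ᵥ (X *ᵥ β) + ϱ • β := by
          rw [hM, add_mulVec, smul_mulVec, one_mulVec, mulVec_mulVec]
        rw [hMβ, mulVec_add]
  rw [mulVec_add, mulVec_add, mulVec_add, neg_smul, mulVec_neg, mulVec_mulVec, mulVec_mulVec _ X]
  nth_rewrite 2 [hβ]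
  rw [← mulVec_mulVec ε (X * M⁻¹) Xᵀ]
  abel

end Spectral

section Risk

variable {n p : ℕ} {X : Matrix (Fin n) (Fin p) ℝ}

theorem gram_eq_conj_diagonal (hn : 1 ≤ n) (hH : ((n : ℝ)⁻¹ • (Xᵀ * X)).IsHermitian) :
    Xᵀ * X = (hH.eigenvectorUnitary : Matrix (Fin p) (Fin p) ℝ)
      * diagonal (fun i => n * hH.eigenvalues i)
      * (hH.eigenvectorUnitary : Matrix (Fin p) (Fin p) ℝ)ᵀ := by
  have hn0 : (n : ℝ) ≠ 0 := by positivity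
  have h := hH.spectral_theorem
  rw [Unitary.conjStarAlgAut_apply] at h
  have hd : diagonal (fun i => n * hH.eigenvalues i)
      = (n : ℝ) • diagonal ((RCLike.ofReal : ℝ → ℝ) ∘ hH.eigenvalues) := by
    rw [← diagonal_smul]; rfl
  rw [hd, mul_smul_comm, smul_mul_assoc]
  calc Xᵀ * X = (n : ℝ) • ((n : ℝ)⁻¹ • (Xᵀ * X)) := by rw [smul_inv_smul₀ hn0]
    _ = _ := congrArg (fun A => (n : ℝ) • A) h

theorem eigenvalues_gram_nonneg (hH : ((n : ℝ)⁻¹ • (Xᵀ * X)).IsHermitian) (i : Fin p) :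
    0 ≤ hH.eigenvalues i := by
  have hpsd : ((n : ℝ)⁻¹ • (Xᵀ * X)).PosSemidef :=
    PosSemidef.smul (by simpa using posSemidef_conjTranspose_mul_self X) (by positivity)
  exact hpsd.eigenvalues_nonneg i

theorem mspeE_ridge_le (hn : 1 ≤ n) (hH : ((n : ℝ)⁻¹ • (Xᵀ * X)).IsHermitian) {τ : ℝ}
    (hτ : 0 < τ) (β : Fin p → ℝ) {F₀ : Measure ℝ} [IsProbabilityMeasure F₀]
    (hmean : ∫ x, x ∂F₀ = 0) (hint : Integrable (fun x => x ^ 2) F₀) :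
    mspeE X β (ridge X (n * τ)) F₀
      ≤ ENNReal.ofReal (τ / 4 * ∑ j, β j ^ 2
        + (∫ x, x ^ 2 ∂F₀) / n * ∑ i, (hH.eigenvalues i / (hH.eigenvalues i + τ)) ^ 2) := by
  have hn0 : (0 : ℝ) < n := by exact_mod_cast hn
  have hϱ : 0 < n * τ := by positivity
  have hLp : MemLp id 2 F₀ := (memLp_two_iff_integrable_sq aestronglyMeasurable_id).mpr hint
  have hG := gram_eq_conj_diagonal hn hH
  have hU : (hH.eigenvectorUnitary : Matrix (Fin p) (Fin p) ℝ)
      * (hH.eigenvectorUnitary : Matrix (Fin p) (Fin p) ℝ)ᵀ = 1 :=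
    Unitary.coe_mul_star_self hH.eigenvectorUnitary
  have ha : ∀ i, 0 ≤ n * hH.eigenvalues i := fun i =>
    mul_nonneg hn0.le (eigenvalues_gram_nonneg hH i)
  have hbias := sum_sq_mulVec_inv_gram_le hU hG ha hϱ (-(n * τ) • β)
  have hvar := sum_sq_hat_matrix hU hG ha hϱ
  have hres : ∀ ε i, (X *ᵥ ridge X (n * τ) (X *ᵥ β + ε)) i - (X *ᵥ β) i = _ := fun ε i =>
    congrFun (mulVec_ridge_sub X hϱ β ε) i
  simp only [Pi.add_apply] at hres
  simp only [mspeE, hres]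
  rw [lintegral_sum_add_mulVec_sq_pi hLp hmean, hvar,
    show (n : ℝ≥0∞)⁻¹ = ENNReal.ofReal (n : ℝ)⁻¹ by
      rw [ENNReal.ofReal_inv_of_pos hn0, ENNReal.ofReal_natCast],
    ← ENNReal.ofReal_mul (by positivity)]
  refine ENNReal.ofReal_le_ofReal ?_
  have hratio : ∀ i, n * hH.eigenvalues i / (n * hH.eigenvalues i + n * τ)
      = hH.eigenvalues i / (hH.eigenvalues i + τ) := fun i => by
    rw [← mul_add, mul_div_mul_left _ _ hn0.ne']
  simp only [hratio]
  have hscale : (4 * (n * τ))⁻¹ * ∑ j, ((-(n * τ)) • β) j ^ 2 = n * (τ / 4 * ∑ j, β j ^ 2) := by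
    simp only [Pi.smul_apply, smul_eq_mul, mul_pow, ← Finset.mul_sum]
    field_simp
  rw [hscale] at hbias
  rw [inv_mul_le_iff₀ hn0, mul_add]
  refine add_le_add hbias (le_of_eq ?_)
  field_simp

theorem antitone_le_mul_rpow_neg {l : Fin p → ℝ} (hanti : Antitone l) {κ k ν : ℝ} (hκ : 0 < κ)
    (hν : 0 < ν) (hn : 1 ≤ n) (hk : (p : ℝ) ≤ k * n)
    (hl : ∀ i : Fin p, (i : ℕ) < min n p → l i ≤ κ * ((i : ℕ) + 1 : ℝ) ^ (-ν)) (i : Fin p) :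
    l i ≤ κ * max 1 k ^ ν * ((i : ℕ) + 1 : ℝ) ^ (-ν) := by
  have hm1 : 1 ≤ max 1 k := le_max_left _ _
  have hi0 : (0 : ℝ) < (i : ℕ) + 1 := by positivity
  rcases lt_or_ge (i : ℕ) n with hi | hi
  · refine (hl i (lt_min hi i.2)).trans ?_
    gcongr
    exact le_mul_of_one_le_right hκ.le (Real.one_le_rpow hm1 hν.le)
  · have hn0 : (0 : ℝ) < n := by exact_mod_cast hn
    have hlt : n - 1 < p := by omega
    have h1 := hl ⟨n - 1, hlt⟩ (lt_min (by simp; omega) hlt)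
    have h2 : l i ≤ l ⟨n - 1, hlt⟩ := hanti (Fin.mk_le_of_le_val (by omega))
    rw [Nat.cast_sub hn] at h1
    simp only [Nat.cast_one, sub_add_cancel] at h1
    refine (h2.trans h1).trans ?_
    rw [mul_assoc]
    gcongr
    have hip : ((i : ℕ) + 1 : ℝ) ≤ max 1 k * n := by
      calc ((i : ℕ) + 1 : ℝ) ≤ p := by exact_mod_cast i.2
        _ ≤ k * n := hk
        _ ≤ max 1 k * n := by gcongr; exact le_max_right _ _
    rw [Real.rpow_neg hn0.le, Real.rpow_neg hi0.le, ← div_eq_mul_inv, le_div_iff₀ (by positivity),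
      inv_mul_le_iff₀ (by positivity), mul_comm, ← Real.mul_rpow (by positivity) hn0.le]
    gcongr

end Risk

/-- **MSPE consistency of ridge regression for near low-rank designs.**
If the sorted eigenvalues of `Σ̂ = (1/n)XᵀX` obey a power-law profile with exponent
`ν`, `‖β‖₂ ≤ b₀`, `p/n` is bounded, and `ϱ/n = n^{−θ}` with `θ = 2ν/3` for
`ν ∈ (0,1/2)` and `θ = ν/(ν+1)` for `ν > 1/2`, then
`mspe(β̂_ϱ|X) ≤ C·n^{−2ν/3}` resp. `C·n^{−ν/(ν+1)}`. -/
theorem ridge_mspe_near_low_rank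
    (κ₁ κ₂ ν k₃ k₄ b₀ σ2 : ℝ)
    (hκ₁ : 0 < κ₁) (hκ₂ : 0 < κ₂) (hν : 0 < ν) (hν' : ν ≠ 1 / 2)
    (hk₃ : 0 < k₃) (hk₄ : k₃ ≤ k₄) (hb₀ : 0 < b₀) (hσ2 : 0 < σ2) :
    ∃ C : ℝ, 0 < C ∧
      ∀ (n p : ℕ), 1 ≤ n →
        k₃ * (n : ℝ) ≤ (p : ℝ) → (p : ℝ) ≤ k₄ * (n : ℝ) →
        ∀ (X : Matrix (Fin n) (Fin p) ℝ)
          (hH : ((n : ℝ)⁻¹ • (Xᵀ * X)).IsHermitian)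
          (e : Equiv.Perm (Fin p)),
          Antitone (fun i => hH.eigenvalues (e i)) →
          (∀ i : Fin p, (i : ℕ) < min n p →
            κ₁ * ((i : ℕ) + 1 : ℝ) ^ (-ν) ≤ hH.eigenvalues (e i) ∧
              hH.eigenvalues (e i) ≤ κ₂ * ((i : ℕ) + 1 : ℝ) ^ (-ν)) →
        ∀ (β : Fin p → ℝ), Real.sqrt (∑ j, β j ^ 2) ≤ b₀ →
        ∀ (F₀ : Measure ℝ), IsProbabilityMeasure F₀ →
          (∫ x, x ∂F₀) = 0 → (∫ x, x ^ 2 ∂F₀) = σ2 →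
          Integrable (fun x => x ^ 2) F₀ →
        mspeE X β
            (ridge X ((n : ℝ) * (n : ℝ) ^ (-(if ν < 1 / 2 then 2 * ν / 3 else ν / (ν + 1)))))
            F₀
          ≤ ENNReal.ofReal
              (C * (if ν < 1 / 2 then (n : ℝ) ^ (-(2 * ν / 3))
                    else (n : ℝ) ^ (-(ν / (ν + 1))))) := by
  set K : ℝ := κ₂ * max 1 k₄ ^ ν with hK
  have hk₄0 : 0 < k₄ := hk₃.trans_le hk₄
  set V : ℝ := if ν < 1 / 2 then K ^ 2 * (k₄ ^ (1 - 2 * ν) / (1 - 2 * ν))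
    else 2 + K ^ 2 / (2 * ν - 1) with hV
  have hV0 : 0 ≤ V := by
    rw [hV]
    split_ifs with h
    · have : 0 < 1 - 2 * ν := by linarith
      positivity
    · have : 0 ≤ 2 * ν - 1 := by linarith
      positivity
  refine ⟨b₀ ^ 2 / 4 + σ2 * V, by positivity, ?_⟩
  intro n p hn _ hpn X hH e hanti heig β hβ F₀ hF₀ hmean hvar hint
  have hn1 : (1 : ℝ) ≤ n := by exact_mod_cast hn
  have hn0 : (0 : ℝ) < n := by linarith
  set θ : ℝ := if ν < 1 / 2 then 2 * ν / 3 else ν / (ν + 1) with hθ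
  have hθ0 : 0 < θ := by
    rw [hθ]
    split_ifs <;> positivity
  rw [show (if ν < 1 / 2 then (n : ℝ) ^ (-(2 * ν / 3)) else (n : ℝ) ^ (-(ν / (ν + 1))))
      = (n : ℝ) ^ (-θ) by rw [hθ]; split_ifs <;> rfl]
  set τ : ℝ := (n : ℝ) ^ (-θ) with hτ
  have hτ0 : 0 < τ := by positivity
  have hτ1 : τ ≤ 1 := Real.rpow_le_one_of_one_le_of_nonpos hn1 (by linarith)
  refine (mspeE_ridge_le hn hH hτ0 β hmean hint).trans (ENNReal.ofReal_le_ofReal ?_)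
  have hbias : ∑ j, β j ^ 2 ≤ b₀ ^ 2 := (Real.sqrt_le_left hb₀.le).mp hβ
  have hl0 : ∀ i, 0 ≤ hH.eigenvalues (e i) := fun i => eigenvalues_gram_nonneg hH (e i)
  have hlK : ∀ i, hH.eigenvalues (e i) ≤ K * ((i : ℕ) + 1 : ℝ) ^ (-ν) :=
    antitone_le_mul_rpow_neg hanti hκ₂ hν hn hpn fun i hi => (heig i hi).2
  have hdf : ∑ i, (hH.eigenvalues i / (hH.eigenvalues i + τ)) ^ 2 ≤ n * (V * τ) := by
    rw [← Equiv.sum_comp e]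
    by_cases h : ν < 1 / 2
    · have hν2 : 0 < 1 - 2 * ν := by linarith
      refine (sum_div_add_sq_le_of_lt hν h hτ0 hl0 hlK).trans ?_
      have hp : (p : ℝ) ^ (1 - 2 * ν) ≤ k₄ ^ (1 - 2 * ν) * (n : ℝ) ^ (1 - 2 * ν) := by
        rw [← Real.mul_rpow hk₄0.le hn0.le]
        gcongr
      have hexp : (n : ℝ) ^ (1 - 2 * ν) = n * τ * τ ^ 2 := by
        rw [hτ, hθ, if_pos h, ← Real.rpow_natCast, ← Real.rpow_mul hn0.le]
        nth_rewrite 2 [← Real.rpow_one (n : ℝ)]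
        rw [← Real.rpow_add hn0, ← Real.rpow_add hn0]
        congr 1
        push_cast
        ring
      rw [hexp] at hp
      calc K ^ 2 / τ ^ 2 * ((p : ℝ) ^ (1 - 2 * ν) / (1 - 2 * ν))
          ≤ K ^ 2 / τ ^ 2 * (k₄ ^ (1 - 2 * ν) * (n * τ * τ ^ 2) / (1 - 2 * ν)) := by gcongr
        _ = n * (V * τ) := by
          rw [hV, if_pos h]
          field_simp
    · have hν2 : 1 / 2 < ν := lt_of_le_of_ne (not_lt.mp h) hν'.symm
      refine (sum_div_add_sq_le_of_gt hν2 hτ0 hτ1 hl0 hlK).trans (le_of_eq ?_)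
      have hexp : τ ^ (-(1 / ν)) = n * τ := by
        rw [hτ, hθ, if_neg h, ← Real.rpow_mul hn0.le]
        nth_rewrite 2 [← Real.rpow_one (n : ℝ)]
        rw [← Real.rpow_add hn0]
        congr 1
        field_simp
        ring
      rw [hexp, hV, if_neg h]
      ring
  rw [hvar]
  calc τ / 4 * ∑ j, β j ^ 2 + σ2 / n * ∑ i, (hH.eigenvalues i / (hH.eigenvalues i + τ)) ^ 2
      ≤ τ / 4 * b₀ ^ 2 + σ2 / n * (n * (V * τ)) := by gcongr
    _ = (b₀ ^ 2 / 4 + σ2 * V) * τ := by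
      field_simp
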